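/- arXiv:2111.01094 — 2 statements merged into one kernel-verified Lean document; each statement's English description precedes it below -/
import Mathlib

section
/- For every polynomial p of degree at most n with real coefficients satisfying |p(x)| ≤ 1 for all x ∈ [-1,1], and every x ∈ [-1,1], we have |p'(x)| ≤ n². -/
open Polynomial Polynomial.Chebyshev Real in
/-- Schur's inequality, at points to the right of all zeros of `T n`. -/
lemma schur_right (n : ℕ) (hn : n ≠ 0) (Q : ℝ[X]) (hQ : Q.degree < n)
    (hb : ∀ θ : ℝ, |Q.eval (cos θ) * sin θ| ≤ 1) (x : ℝ) (hx1 : x ≤ 1)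
    (hx : cos (π / (2 * n)) ≤ x) : |Q.eval x| ≤ n := by
  classical
  have hn0 : (0 : ℝ) < n := by positivity
  set φ : ℕ → ℝ := fun k => (2 * k + 1) * π / (2 * n) with hφ
  set v : ℕ → ℝ := fun k => cos (φ k) with hv
  set s := Finset.range n with hs
  have hinj : Set.InjOn v s := (Finset.range n).nodup_map_iff_injOn.mp (roots_T_real_nodup n)
  have hφ0 : ∀ i, 0 < φ i := fun i => by simp only [hφ]; positivity
  have hφ1 : ∀ i ∈ s, φ i < π := by
    intro i hi
    have : (i : ℝ) + 1 ≤ n := by exact_mod_cast Finset.mem_range.mp hi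
    simp only [hφ]
    rw [div_lt_iff₀ (by positivity)]
    nlinarith [pi_pos]
  have hsin : ∀ i ∈ s, 0 < sin (φ i) := fun i hi =>
    sin_pos_of_pos_of_lt_pi (hφ0 i) (hφ1 i hi)
  have hxv : ∀ i ∈ s, 0 ≤ x - v i := by
    intro i hi
    have : v i ≤ cos (π / (2 * n)) := by
      apply cos_le_cos_of_nonneg_of_le_pi (by positivity) (hφ1 i hi).le
      simp only [hφ]
      gcongr
      nlinarith [pi_pos, (Nat.cast_nonneg i : (0 : ℝ) ≤ i)]
    linarith
  have hxm : -1 ≤ x := by linarith [neg_one_le_cos (π / (2 * n))]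
  obtain ⟨c, hc, hT⟩ : ∃ c : ℝ, 0 < c ∧ T ℝ n = C c * Lagrange.nodal s v := by
    refine ⟨(T ℝ n).leadingCoeff, by simp, ?_⟩
    have hcard : Multiset.card (T ℝ n).roots = (T ℝ n).natDegree := by
      rw [roots_T_real, natDegree_T]
      simp only [Finset.card_val, Int.natAbs_natCast]
      rw [Finset.card_image_of_injOn hinj, Finset.card_range]
    have h := C_leadingCoeff_mul_prod_multiset_X_sub_C hcard
    rw [roots_T_real] at h
    rw [Lagrange.nodal_eq, ← Finset.prod_image (f := fun a => X - C a) (g := v) hinj]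
    exact h.symm
  set G : ℕ → ℝ[X] := fun i => Lagrange.nodal (s.erase i) v with hG
  have hder : ∀ y, (derivative (T ℝ n)).eval y = ∑ i ∈ s, c * (G i).eval y := by
    intro y
    rw [hT, derivative_C_mul, Lagrange.derivative_nodal, eval_mul, eval_C, eval_finsetSum,
      Finset.mul_sum]
  have hGv : ∀ i ∈ s, |c * (G i).eval (v i)| * sin (φ i) = n := by
    intro i hi
    have h1 : (derivative (T ℝ n)).eval (v i) = c * (G i).eval (v i) := by
      rw [hT, derivative_C_mul, eval_mul, eval_C, Lagrange.eval_nodal_derivative_eval_node_eq hi]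
    rw [← h1, T_derivative_eq_U, ← abs_of_pos (hsin i hi), ← abs_mul]
    have h2 := U_real_cos (φ i) ((n : ℤ) - 1)
    have h3 : cos (n * φ i) = 0 := by
      rw [cos_eq_zero_iff]
      refine ⟨i, ?_⟩
      simp only [hφ]
      push_cast
      field_simp
    have h4 : |sin (n * φ i)| = 1 := by
      have := sin_sq_add_cos_sq (n * φ i)
      rw [h3] at this
      have h5 : sin (n * φ i) ^ 2 = 1 := by linarith
      rw [← sq_eq_sq₀ (abs_nonneg _) (by norm_num), sq_abs, h5]; norm_num
    have h6 : (((n : ℤ) : ℝ[X]) * U ℝ ((n : ℤ) - 1)).eval (v i) * sin (φ i)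
        = n * sin (n * φ i) := by
      rw [eval_mul, mul_assoc]
      simp only [hv]
      rw [h2]
      simp
    rw [h6, abs_mul, h4]
    simp
  have hGx : ∀ i ∈ s, 0 ≤ (G i).eval x := by
    intro i hi
    simp only [hG, Lagrange.eval_nodal]
    exact Finset.prod_nonneg fun j hj => hxv j (Finset.mem_of_mem_erase hj)
  have hint : Q.eval x = ∑ i ∈ s, Q.eval (v i) * ((G i).eval x / (G i).eval (v i)) := by
    conv_lhs => rw [Lagrange.eq_interpolate hinj (f := Q) (by simpa [hs] using hQ)]
    rw [Lagrange.interpolate_apply, eval_finsetSum]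
    refine Finset.sum_congr rfl fun i hi => ?_
    rw [eval_mul, eval_C]
    congr 1
    simp only [Lagrange.basis, Lagrange.basisDivisor, eval_prod, hG, Lagrange.eval_nodal,
      eval_mul, eval_sub, eval_X, eval_C]
    rw [← Finset.prod_div_distrib]
    refine Finset.prod_congr rfl fun j hj => ?_
    rw [div_eq_inv_mul]
  have hbound : |Q.eval x| ≤ (derivative (T ℝ n)).eval x / n := by
    rw [hint, hder, Finset.sum_div]
    refine (Finset.abs_sum_le_sum_abs _ _).trans (Finset.sum_le_sum fun i hi => ?_)
    have h1 := hb (φ i)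
    have h2 := hGv i hi
    have h3 := hsin i hi
    rw [abs_mul, abs_of_pos h3] at h1
    rw [abs_mul, abs_of_pos hc] at h2
    have hGpos : 0 < |(G i).eval (v i)| := by
      rcases (abs_nonneg ((G i).eval (v i))).eq_or_lt with h | h
      · rw [← h] at h2; simp at h2; exact absurd h2.symm (by exact_mod_cast hn)
      · exact h
    rw [abs_mul, abs_div, abs_of_nonneg (hGx i hi)]
    rw [mul_div_assoc', div_le_div_iff₀ hGpos hn0]
    have h4 : |Q.eval (v i)| * n ≤ c * |(G i).eval (v i)| := by
      calc |Q.eval (v i)| * n = |Q.eval (v i)| * (sin (φ i)) * (c * |(G i).eval (v i)|) := by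
            rw [← h2]; ring
        _ ≤ 1 * (c * |(G i).eval (v i)|) := by
            gcongr
        _ = _ := one_mul _
    nlinarith [mul_le_mul_of_nonneg_left h4 (hGx i hi)]
  have hT1 := abs_iterate_derivative_T_real_le n 1 (x := x) (abs_le.mpr ⟨hxm, hx1⟩)
  simp only [Function.iterate_one, derivative_T_eval_one] at hT1
  have hT2 := (le_abs_self _).trans hT1
  refine hbound.trans ?_
  rw [div_le_iff₀ hn0]
  push_cast at hT2
  nlinarith

open Polynomial Polynomial.Chebyshev Real in
/-- Schur's inequality. -/
lemma schur_ineq (n : ℕ) (hn : n ≠ 0) (Q : ℝ[X]) (hQ : Q.degree < n)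
    (hb : ∀ θ : ℝ, |Q.eval (cos θ) * sin θ| ≤ 1) (x : ℝ) (hx : x ∈ Set.Icc (-1 : ℝ) 1) :
    |Q.eval x| ≤ n := by
  wlog hx0 : 0 ≤ x generalizing Q x
  · have h := this (Q.comp (-X)) ?_ ?_ (-x) ⟨by linarith [hx.2], by linarith [hx.1]⟩ (by linarith)
    · simpa using h
    · rcases eq_or_ne Q 0 with rfl | hQ0
      · simp
      · refine lt_of_le_of_lt degree_le_natDegree ?_
        rw [natDegree_comp, natDegree_neg, natDegree_X, mul_one, ← degree_eq_natDegree hQ0]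
        exact hQ
    · intro θ
      have := hb (π - θ)
      simpa using this
  have hn0 : (0 : ℝ) < n := by positivity
  rcases le_total (cos (π / (2 * n))) x with h | h
  · exact schur_right n hn Q hQ hb x hx.2 h
  · have h1 := hb (arccos x)
    rw [cos_arccos hx.1 hx.2, abs_mul] at h1
    have h2 : π / (2 * n) ≤ arccos x := by
      have : arccos (cos (π / (2 * n))) = π / (2 * n) := by
        apply arccos_cos (by positivity)
        rw [div_le_iff₀ (by positivity)]
        have : (1 : ℝ) ≤ n := by exact_mod_cast Nat.one_le_iff_ne_zero.mpr hn
        nlinarith [pi_pos]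
      rw [← this]
      exact arccos_le_arccos h
    have h3 := mul_le_sin (arccos_nonneg x) (arccos_le_pi_div_two.mpr hx0)
    have h4 : 1 / (n : ℝ) ≤ sin (arccos x) := by
      refine le_trans ?_ h3
      calc 1 / (n : ℝ) = 2 / π * (π / (2 * n)) := by field_simp
        _ ≤ _ := by gcongr
    have h5 : |Q.eval x| * (1 / n) ≤ 1 := by
      refine le_trans ?_ h1
      gcongr
      exact h4.trans (le_abs_self _)
    rw [mul_one_div, div_le_iff₀ hn0] at h5
    linarith

open Polynomial Real in
lemma trig_split (a : ℝ) (n : ℕ) : ∀ p : ℝ[X], p.natDegree ≤ n → ∃ A B : ℝ[X],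
    A.degree < (n + 1 : ℕ) ∧ B.degree < n ∧
    ∀ θ, p.eval (cos (a + θ)) = A.eval (cos θ) + sin θ * B.eval (cos θ) := by
  induction n with
  | zero =>
    intro p hp
    rw [eq_C_of_natDegree_le_zero hp]
    refine ⟨C (p.coeff 0), 0, ?_, ?_, by simp⟩
    · exact lt_of_le_of_lt degree_C_le (by norm_num)
    · simp
  | succ n ih =>
    intro p hp
    obtain ⟨A, B, hA, hB, h⟩ := ih p.divX (by rw [natDegree_divX_eq_natDegree_tsub_one]; omega)
    refine ⟨C (cos a) * X * A - C (sin a) * (1 - X ^ 2) * B + C (p.coeff 0),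
      C (cos a) * X * B - C (sin a) * A, ?_, ?_, ?_⟩
    · rw [degree_lt_iff_coeff_zero] at *
      intro m hm
      obtain ⟨m, rfl⟩ : ∃ k, m = k + 2 := ⟨m - 2, by omega⟩
      have e : C (cos a) * X * A - C (sin a) * (1 - X ^ 2) * B + C (p.coeff 0)
        = C (cos a) * (A * X) - C (sin a) * (B - B * X ^ 2) + C (p.coeff 0) := by ring
      rw [e]
      simp only [coeff_add, coeff_sub, coeff_C_mul, coeff_mul_X_pow]
      rw [coeff_mul_X, hA _ (by omega), hB _ (by omega), hB _ (by omega), coeff_C]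
      simp
    · rw [degree_lt_iff_coeff_zero] at *
      intro m hm
      obtain ⟨m, rfl⟩ : ∃ k, m = k + 1 := ⟨m - 1, by omega⟩
      have e : C (cos a) * X * B - C (sin a) * A
        = C (cos a) * (B * X) - C (sin a) * A := by ring
      rw [e]
      simp only [coeff_sub, coeff_C_mul, coeff_mul_X]
      rw [hA _ (by omega), hB _ (by omega)]
      simp
    · intro θ
      conv_lhs => rw [← divX_mul_X_add p]
      simp only [eval_add, eval_mul, eval_X, eval_C, eval_sub, eval_one, eval_pow, h]
      rw [cos_add]
      linear_combination (-sin a * eval (cos θ) B) * (sin_sq_add_cos_sq θ)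

open Polynomial Real in
lemma bernstein_ineq (n : ℕ) (hn : n ≠ 0) (p : ℝ[X]) (hdeg : p.natDegree ≤ n)
    (hb : ∀ x ∈ Set.Icc (-1 : ℝ) 1, |p.eval x| ≤ 1) (a : ℝ) :
    |p.derivative.eval (cos a) * sin a| ≤ n := by
  obtain ⟨A, B, hA, hB, h⟩ := trig_split a n p hdeg
  have h1 := schur_ineq n hn B hB (fun θ => by
    have e1 := h θ
    have e2 := h (-θ)
    simp only [cos_neg, sin_neg] at e2
    have b1 := abs_le.mp (hb (cos (a + θ)) (cos_mem_Icc _))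
    have b2 := abs_le.mp (hb (cos (a + -θ)) (cos_mem_Icc _))
    rw [abs_le]
    constructor <;> nlinarith) 1 (by norm_num)
  have d1 : HasDerivAt (fun θ => p.eval (cos (a + θ)))
      (p.derivative.eval (cos (a + 0)) * (-sin (a + 0) * 1)) 0 :=
    HasDerivAt.comp (h₂ := fun y => p.eval y) (h := fun θ => cos (a + θ)) (0 : ℝ)
      (p.hasDerivAt (cos (a + 0)))
      ((hasDerivAt_cos (a + 0)).comp (0 : ℝ) ((hasDerivAt_id (0 : ℝ)).const_add a))
  have dc := hasDerivAt_cos (0 : ℝ)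
  have d2 := ((A.hasDerivAt (cos 0)).comp (0 : ℝ) dc).add
    ((hasDerivAt_sin (0 : ℝ)).mul ((B.hasDerivAt (cos 0)).comp (0 : ℝ) dc))
  have d3 := d1.unique (d2.congr_of_eventuallyEq (Filter.Eventually.of_forall h))
  simp at d3
  rw [← abs_neg, d3]
  exact h1

theorem markov_inequality (n : ℕ) (p : Polynomial ℝ) (hdeg : p.natDegree ≤ n)
    (hb : ∀ x ∈ Set.Icc (-1 : ℝ) 1, |p.eval x| ≤ 1) :
    ∀ x ∈ Set.Icc (-1 : ℝ) 1, |p.derivative.eval x| ≤ (n : ℝ) ^ 2 := by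
  intro x hx
  rcases Nat.eq_zero_or_pos n with rfl | hn
  · rw [Polynomial.eq_C_of_natDegree_le_zero hdeg]; simp
  have hn0 : (0 : ℝ) < n := by exact_mod_cast hn
  have h := schur_ineq n hn.ne' (Polynomial.C ((n : ℝ)⁻¹) * p.derivative) ?_ ?_ x hx
  · rw [Polynomial.eval_mul, Polynomial.eval_C, abs_mul, abs_of_pos (by positivity),
      inv_mul_le_iff₀ hn0] at h
    nlinarith
  · rw [Polynomial.degree_lt_iff_coeff_zero]
    intro m hm
    rw [Polynomial.coeff_C_mul, Polynomial.coeff_derivative,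
      Polynomial.coeff_eq_zero_of_natDegree_lt (by omega)]
    simp
  · intro θ
    have := bernstein_ineq n hn.ne' p hdeg hb θ
    rw [Polynomial.eval_mul, Polynomial.eval_C, mul_assoc, abs_mul, abs_of_pos (by positivity),
      inv_mul_le_iff₀ hn0]
    linarith
end

section
/- Let X = L²((0,∞), e^{-t} dt). Then sup over nonzero real polynomials p of degree at most n of ‖p'‖_X / ‖p‖_X equals (2 sin(π/(4n+2)))^{-1}. -/
open MeasureTheory

/-- The `L²((0,∞), e^{-t} dt)` norm of a polynomial. -/
noncomputable def laguerreNorm (p : Polynomial ℝ) : ℝ :=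
  Real.sqrt (∫ t in Set.Ioi (0 : ℝ), (p.eval t) ^ 2 * Real.exp (-t))

/-- The functional `p ↦ ∫_0^∞ p e^{-t} dt`. -/
noncomputable def lamT (p : Polynomial ℝ) : ℝ :=
  ∫ t in Set.Ioi (0 : ℝ), p.eval t * Real.exp (-t)

theorem integrable_monomT (k : ℕ) :
    IntegrableOn (fun t : ℝ => t ^ k * Real.exp (-t)) (Set.Ioi 0) := by
  have h := Real.GammaIntegral_convergent (s := (k : ℝ) + 1) (by positivity)
  refine h.congr_fun ?_ measurableSet_Ioi
  intro t ht
  simp [mul_comm]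

theorem integral_monomT (k : ℕ) :
    ∫ t in Set.Ioi (0 : ℝ), t ^ k * Real.exp (-t) = (k.factorial : ℝ) := by
  rw [← Real.Gamma_nat_eq_factorial, Real.Gamma_eq_integral (by positivity)]
  refine setIntegral_congr_fun measurableSet_Ioi ?_
  intro t ht
  simp [mul_comm]

theorem integrable_polyT (p : Polynomial ℝ) :
    IntegrableOn (fun t : ℝ => p.eval t * Real.exp (-t)) (Set.Ioi 0) := by
  induction p using Polynomial.induction_on' with
  | add p q hp hq =>
    simp only [Polynomial.eval_add, add_mul]
    exact hp.add hq
  | monomial k a =>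
    simp only [Polynomial.eval_monomial, mul_assoc]
    exact (integrable_monomT k).const_mul a

theorem lamT_add (p q : Polynomial ℝ) : lamT (p + q) = lamT p + lamT q := by
  unfold lamT
  rw [← integral_add (integrable_polyT p) (integrable_polyT q)]
  simp [add_mul]

theorem lamT_C_mul (a : ℝ) (p : Polynomial ℝ) : lamT (Polynomial.C a * p) = a * lamT p := by
  unfold lamT
  rw [← integral_const_mul]
  simp [mul_assoc]

theorem lamT_sub (p q : Polynomial ℝ) : lamT (p - q) = lamT p - lamT q := by
  have := lamT_add (p - q) q
  rw [sub_add_cancel] at this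
  linarith

theorem lamT_zero : lamT 0 = 0 := by simp [lamT]

theorem lamT_sum {s : Finset ℕ} (f : ℕ → Polynomial ℝ) :
    lamT (∑ i ∈ s, f i) = ∑ i ∈ s, lamT (f i) := by
  classical
  induction s using Finset.induction_on with
  | empty => simp [lamT_zero]
  | insert a s ha ih => rw [Finset.sum_insert ha, Finset.sum_insert ha, lamT_add, ih]

theorem lamT_monomial (k : ℕ) (a : ℝ) :
    lamT (Polynomial.monomial k a) = a * (k.factorial : ℝ) := by
  unfold lamT
  rw [← integral_monomT, ← integral_const_mul]
  simp [mul_assoc]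

theorem lamT_deriv (p : Polynomial ℝ) : lamT p.derivative = lamT p - p.eval 0 := by
  induction p using Polynomial.induction_on' with
  | add p q hp hq => rw [Polynomial.derivative_add, lamT_add, lamT_add, hp, hq, Polynomial.eval_add]; ring
  | monomial k a =>
    rw [Polynomial.derivative_monomial, lamT_monomial, lamT_monomial]
    cases k with
    | zero => simp
    | succ k => simp [Nat.factorial_succ]; ring

/-- Laguerre polynomials. -/
noncomputable def lagT (k : ℕ) : Polynomial ℝ :=
  ∑ i ∈ Finset.range (k + 1), Polynomial.monomial i ((k.choose i : ℝ) * (-1) ^ i / (i.factorial : ℝ))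

theorem lagT_coeff (k i : ℕ) :
    (lagT k).coeff i = (k.choose i : ℝ) * (-1) ^ i / (i.factorial : ℝ) := by
  unfold lagT
  rw [Polynomial.finsetSum_coeff]
  simp only [Polynomial.coeff_monomial]
  rw [Finset.sum_ite_eq' (Finset.range (k + 1)) i]
  split_ifs with h
  · rfl
  · rw [Nat.choose_eq_zero_of_lt (by simp at h; omega)]; simp

theorem lagT_zero : lagT 0 = 1 := by simp [lagT]

theorem lagT_eval (k : ℕ) : (lagT k).eval 0 = 1 := by
  rw [← Polynomial.coeff_zero_eq_eval_zero, lagT_coeff]; simp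

theorem lagT_deg (k : ℕ) : (lagT k).natDegree ≤ k := by
  rw [Polynomial.natDegree_le_iff_coeff_eq_zero]
  intro i hi
  rw [lagT_coeff, Nat.choose_eq_zero_of_lt hi]; simp

theorem lagT_rec (k : ℕ) :
    (lagT (k + 1)).derivative = (lagT k).derivative - lagT k := by
  ext i
  rw [Polynomial.coeff_sub, Polynomial.coeff_derivative, Polynomial.coeff_derivative,
    lagT_coeff, lagT_coeff, lagT_coeff, Nat.choose_succ_succ, Nat.factorial_succ]
  have : (i.factorial : ℝ) ≠ 0 := by positivity
  push_cast
  field_simp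
  ring

theorem lagT_H (i j : ℕ) :
    lamT ((lagT i).derivative * (lagT j).derivative) = (min i j : ℕ) := by
  induction i generalizing j with
  | zero => simp [lagT_zero, lamT_zero]
  | succ i ih =>
    cases j with
    | zero => simp [lagT_zero, lamT_zero]
    | succ j =>
      have h := lamT_deriv (lagT i * lagT j)
      rw [Polynomial.derivative_mul, lamT_add, Polynomial.eval_mul, lagT_eval, lagT_eval] at h
      have e : (lagT (i+1)).derivative * (lagT (j+1)).derivative
          = (lagT i).derivative * (lagT j).derivative + lagT i * lagT j
            - ((lagT i).derivative * lagT j + lagT i * (lagT j).derivative) := by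
        rw [lagT_rec, lagT_rec]; ring
      rw [e, lamT_sub, lamT_add, lamT_add, ih, Nat.succ_min_succ]
      push_cast
      linarith

theorem lagT_G (i j : ℕ) : lamT (lagT i * lagT j) = if i = j then 1 else 0 := by
  have e : lagT i * lagT j = ((lagT i).derivative * (lagT j).derivative
      - (lagT i).derivative * (lagT (j+1)).derivative)
      - ((lagT (i+1)).derivative * (lagT j).derivative
      - (lagT (i+1)).derivative * (lagT (j+1)).derivative) := by
    rw [lagT_rec, lagT_rec]; ring
  rw [e, lamT_sub, lamT_sub, lamT_sub, lagT_H, lagT_H, lagT_H, lagT_H]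
  rcases lt_trichotomy i j with h | h | h
  · rw [min_eq_left (by omega), min_eq_left (by omega), min_eq_left (by omega),
      min_eq_left (by omega), if_neg (by omega)]; ring
  · subst h
    rw [min_eq_left (by omega), min_eq_left (by omega), min_eq_right (by omega),
      min_eq_left (by omega), if_pos rfl]; push_cast; ring
  · rw [min_eq_right (by omega), min_eq_right (by omega), min_eq_right (by omega),
      min_eq_right (by omega), if_neg (by omega)]; ring

theorem parsevalT (m : ℕ) (b : ℕ → ℝ) :
    lamT ((∑ j ∈ Finset.range m, Polynomial.C (b j) * lagT j) ^ 2)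
      = ∑ j ∈ Finset.range m, b j ^ 2 := by
  rw [sq, Finset.sum_mul_sum, lamT_sum]
  refine Finset.sum_congr rfl fun i hi => ?_
  rw [lamT_sum]
  have : ∀ j, lamT (Polynomial.C (b i) * lagT i * (Polynomial.C (b j) * lagT j))
      = if i = j then b i * b j else 0 := by
    intro j
    rw [show Polynomial.C (b i) * lagT i * (Polynomial.C (b j) * lagT j)
      = Polynomial.C (b i) * (Polynomial.C (b j) * (lagT i * lagT j)) by ring,
      lamT_C_mul, lamT_C_mul, lagT_G]
    split_ifs <;> ring
  simp only [this]
  rw [Finset.sum_ite_eq, if_pos hi, sq]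

/-- polynomial built from the coefficients of its derivative -/
noncomputable def bldT (n : ℕ) (c : ℝ) (b : ℕ → ℝ) : Polynomial ℝ :=
  Polynomial.C c + ∑ j ∈ Finset.range n, Polynomial.C (b j) * (lagT j - lagT (j + 1))

theorem bldT_deriv (n : ℕ) (c : ℝ) (b : ℕ → ℝ) :
    (bldT n c b).derivative = ∑ j ∈ Finset.range n, Polynomial.C (b j) * lagT j := by
  unfold bldT
  simp [lagT_rec]

theorem bldT_eq (n : ℕ) (c : ℝ) (b : ℕ → ℝ) :
    bldT n c b + Polynomial.C (b n) * lagT n = ∑ j ∈ Finset.range (n + 1),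
      Polynomial.C (if j = 0 then c + b 0 else b j - b (j - 1)) * lagT j := by
  induction n with
  | zero => simp [bldT, lagT_zero]
  | succ n ih =>
    rw [Finset.sum_range_succ, ← ih]
    unfold bldT
    rw [Finset.sum_range_succ]
    simp
    ring

theorem bldT_norm (n : ℕ) (c : ℝ) (b : ℕ → ℝ) (hb : b n = 0) :
    lamT (bldT n c b ^ 2) = (c + b 0) ^ 2 + ∑ j ∈ Finset.range n, (b j - b (j + 1)) ^ 2 := by
  have h := bldT_eq n c b
  rw [hb] at h
  simp only [Polynomial.C_0, zero_mul, add_zero] at h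
  rw [h, parsevalT, Finset.sum_range_succ']
  simp only [Nat.add_eq_zero_iff, one_ne_zero, and_false, if_false, if_true, Nat.add_sub_cancel]
  rw [add_comm]
  congr 1
  exact Finset.sum_congr rfl fun j _ => by ring

theorem expandT (n : ℕ) (p : Polynomial ℝ) (hp : p.natDegree ≤ n) :
    ∃ (c : ℝ) (b : ℕ → ℝ), p = bldT n c b ∧ b n = 0 := by
  induction n generalizing p with
  | zero =>
    refine ⟨p.coeff 0, 0, ?_, rfl⟩
    simp only [bldT, Finset.range_zero, Finset.sum_empty, add_zero]
    exact Polynomial.eq_C_of_natDegree_le_zero hp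
  | succ n ih =>
    obtain ⟨c, b, h, hb⟩ := ih p.derivative
      ((Polynomial.natDegree_derivative_le p).trans (by omega))
    have e := bldT_eq n c b
    rw [hb] at e
    simp only [Polynomial.C_0, zero_mul, add_zero] at e
    set d : ℕ → ℝ := fun j => if j = 0 then c + b 0 else b j - b (j - 1) with hd
    let d' : ℕ → ℝ := fun j => if j < n + 1 then d j else 0
    have h1 : (p - bldT (n+1) 0 d').derivative = 0 := by
      rw [Polynomial.derivative_sub, bldT_deriv, h, e, sub_eq_zero]
      refine Finset.sum_congr rfl fun j hj => ?_
      simp only [d', if_pos (Finset.mem_range.mp hj), hd]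
    have h2 := Polynomial.eq_C_of_derivative_eq_zero h1
    refine ⟨(p - bldT (n+1) 0 d').coeff 0, d', ?_, by simp [d']⟩
    have h3 : ∀ x, bldT (n+1) x d' = Polynomial.C x + bldT (n+1) 0 d' := by
      intro x; simp [bldT]
    rw [h3, ← h2]; ring

theorem bldT_deg (n : ℕ) (c : ℝ) (b : ℕ → ℝ) : (bldT n c b).natDegree ≤ n := by
  unfold bldT
  refine Polynomial.natDegree_add_le_of_degree_le (by simp) ?_
  refine Polynomial.natDegree_sum_le_of_forall_le _ _ fun j hj => ?_
  have := Finset.mem_range.mp hj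
  refine (Polynomial.natDegree_C_mul_le _ _).trans ?_
  have h1 : (lagT j).natDegree ≤ n := (lagT_deg j).trans (by omega)
  have h2 : (lagT (j+1)).natDegree ≤ n := (lagT_deg (j+1)).trans (by omega)
  exact (Polynomial.natDegree_sub_le _ _).trans (max_le h1 h2)

theorem laguerreNorm_eqT (p : Polynomial ℝ) : laguerreNorm p = Real.sqrt (lamT (p ^ 2)) := by
  simp [laguerreNorm, lamT]

theorem cosrecT (θ x : ℝ) :
    Real.cos (x + 2 * θ) + Real.cos (x - 2 * θ) = (2 - (2 * Real.sin θ) ^ 2) * Real.cos x := by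
  rw [Real.cos_add, Real.cos_sub, Real.cos_two_mul, Real.cos_sq']
  ring

theorem eigT (θ : ℝ) (m : ℕ) :
    ∑ j ∈ Finset.range m, (Real.cos ((2 * (j:ℝ) + 1) * θ) - Real.cos ((2 * ((j+1 : ℕ):ℝ) + 1) * θ)) ^ 2
      = (2 * Real.sin θ) ^ 2 * ∑ j ∈ Finset.range m, Real.cos ((2 * (j:ℝ) + 1) * θ) ^ 2
        + Real.cos ((2 * (m:ℝ) + 1) * θ) ^ 2
        - Real.cos ((2 * (m:ℝ) - 1) * θ) * Real.cos ((2 * (m:ℝ) + 1) * θ) := by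
  induction m with
  | zero => simp; ring
  | succ m ih =>
    rw [Finset.sum_range_succ, Finset.sum_range_succ, ih]
    have h := cosrecT θ ((2 * (m:ℝ) + 1) * θ)
    rw [show (2 * (m:ℝ) + 1) * θ - 2 * θ = (2 * (m:ℝ) - 1) * θ by ring,
      show (2 * (m:ℝ) + 1) * θ + 2 * θ = (2 * ((m+1:ℕ):ℝ) + 1) * θ by push_cast; ring] at h
    rw [show (2 * ((m+1:ℕ):ℝ) - 1) * θ = (2 * (m:ℝ) + 1) * θ by push_cast; ring]
    linear_combination (Real.cos ((2 * (m:ℝ) + 1) * θ)) * (-h)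

theorem piconeT (θ : ℝ) (n : ℕ) (hpos : ∀ j < n, 0 < Real.cos ((2 * (j:ℝ) + 1) * θ))
    (b : ℕ → ℝ) (m : ℕ) (hm : m < n) :
    (2 * Real.sin θ) ^ 2 * ∑ j ∈ Finset.range m, b j ^ 2
      + (1 - Real.cos ((2 * (m:ℝ) - 1) * θ) / Real.cos ((2 * (m:ℝ) + 1) * θ)) * b m ^ 2
    ≤ ∑ j ∈ Finset.range m, (b j - b (j + 1)) ^ 2 := by
  induction m with
  | zero =>
    have := hpos 0 hm
    simp at this
    simp [this.ne']
  | succ m ih =>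
    have ih := ih (by omega)
    rw [Finset.sum_range_succ, Finset.sum_range_succ]
    have h := cosrecT θ ((2 * (m:ℝ) + 1) * θ)
    rw [show (2 * (m:ℝ) + 1) * θ - 2 * θ = (2 * (m:ℝ) - 1) * θ by ring,
      show (2 * (m:ℝ) + 1) * θ + 2 * θ = (2 * ((m+1:ℕ):ℝ) + 1) * θ by push_cast; ring] at h
    rw [show (2 * ((m+1:ℕ):ℝ) - 1) * θ = (2 * (m:ℝ) + 1) * θ by push_cast; ring]
    have p0 := hpos m (by omega)
    have p1 := hpos (m+1) hm
    set u := Real.cos ((2 * (m:ℝ) - 1) * θ)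
    set v := Real.cos ((2 * (m:ℝ) + 1) * θ)
    set w := Real.cos ((2 * ((m+1:ℕ):ℝ) + 1) * θ)
    have e : (b m - b (m+1)) ^ 2 - (2 * Real.sin θ) ^ 2 * b m ^ 2
        - (1 - v / w) * b (m+1) ^ 2 + (1 - u / v) * b m ^ 2
        = (w * b m - v * b (m+1)) ^ 2 / (v * w) := by
      field_simp
      linear_combination (-(b m ^ 2 * w)) * h
    have : 0 ≤ (w * b m - v * b (m+1)) ^ 2 / (v * w) := by positivity
    linarith

theorem discrT (θ : ℝ) (n : ℕ) (hn : 1 ≤ n)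
    (hpos : ∀ j < n, 0 < Real.cos ((2 * (j:ℝ) + 1) * θ))
    (h0 : Real.cos ((2 * (n:ℝ) + 1) * θ) = 0)
    (b : ℕ → ℝ) (hb : b n = 0) :
    (2 * Real.sin θ) ^ 2 * ∑ j ∈ Finset.range n, b j ^ 2
    ≤ ∑ j ∈ Finset.range n, (b j - b (j + 1)) ^ 2 := by
  obtain ⟨m, rfl⟩ : ∃ m, n = m + 1 := ⟨n - 1, by omega⟩
  have ih := piconeT θ (m+1) hpos b m (by omega)
  rw [Finset.sum_range_succ, Finset.sum_range_succ, hb]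
  have h := cosrecT θ ((2 * (m:ℝ) + 1) * θ)
  rw [show (2 * (m:ℝ) + 1) * θ - 2 * θ = (2 * (m:ℝ) - 1) * θ by ring,
    show (2 * (m:ℝ) + 1) * θ + 2 * θ = (2 * ((m+1:ℕ):ℝ) + 1) * θ by push_cast; ring, h0] at h
  have p0 := hpos m (by omega)
  set u := Real.cos ((2 * (m:ℝ) - 1) * θ)
  set v := Real.cos ((2 * (m:ℝ) + 1) * θ)
  have e : u / v = 2 - (2 * Real.sin θ) ^ 2 := by
    rw [div_eq_iff p0.ne']; linarith
  rw [e] at ih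
  linarith

theorem turan_laguerre (n : ℕ) (hn : 1 ≤ n) :
    sSup {r : ℝ | ∃ p : Polynomial ℝ, p ≠ 0 ∧ p.natDegree ≤ n ∧
        r = laguerreNorm p.derivative / laguerreNorm p} =
      (2 * Real.sin (Real.pi / (4 * n + 2)))⁻¹ := by
  set θ := Real.pi / (4 * (n:ℝ) + 2) with hθ
  have hpi := Real.pi_pos
  have hθ0 : 0 < θ := by positivity
  have hθn : (2 * (n:ℝ) + 1) * θ = Real.pi / 2 := by
    rw [hθ]; field_simp; ring
  have hs : 0 < Real.sin θ := by
    refine Real.sin_pos_of_pos_of_lt_pi hθ0 ?_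
    have : (0:ℝ) ≤ n := by positivity
    nlinarith
  have hpos : ∀ j < n, 0 < Real.cos ((2 * (j:ℝ) + 1) * θ) := by
    intro j hj
    have hj' : (j:ℝ) < n := by exact_mod_cast hj
    have : 0 < (2 * (j:ℝ) + 1) * θ := by positivity
    refine Real.cos_pos_of_mem_Ioo ⟨by linarith, ?_⟩
    rw [← hθn]
    exact mul_lt_mul_of_pos_right (by linarith) hθ0
  have h0 : Real.cos ((2 * (n:ℝ) + 1) * θ) = 0 := by rw [hθn, Real.cos_pi_div_two]
  refine IsGreatest.csSup_eq ⟨?_, ?_⟩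
  · set b : ℕ → ℝ := fun j => Real.cos ((2 * (j:ℝ) + 1) * θ) with hb
    have hd : lamT ((bldT n (-b 0) b).derivative ^ 2) = ∑ j ∈ Finset.range n, b j ^ 2 := by
      rw [bldT_deriv, parsevalT]
    have hp : lamT ((bldT n (-b 0) b) ^ 2)
        = (2 * Real.sin θ) ^ 2 * ∑ j ∈ Finset.range n, b j ^ 2 := by
      rw [bldT_norm _ _ _ h0]
      have := eigT θ n
      rw [h0] at this
      simp only [hb]
      rw [this]; ring
    have hS : 0 < ∑ j ∈ Finset.range n, b j ^ 2 :=
      Finset.sum_pos (fun j hj => pow_pos (hpos j (Finset.mem_range.mp hj)) 2)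
        ⟨0, Finset.mem_range.mpr hn⟩
    refine ⟨bldT n (-b 0) b, ?_, bldT_deg _ _ _, ?_⟩
    · intro h
      rw [h] at hd
      simp [lamT_zero] at hd
      linarith
    · rw [laguerreNorm_eqT, laguerreNorm_eqT, hd, hp, Real.sqrt_mul (by positivity),
        Real.sqrt_sq (by positivity)]
      have := Real.sqrt_pos.mpr hS
      field_simp
  · rintro r ⟨p, -, hdeg, rfl⟩
    obtain ⟨c, b, rfl, hb⟩ := expandT n p hdeg
    rw [laguerreNorm_eqT, laguerreNorm_eqT, bldT_deriv, parsevalT, bldT_norm _ _ _ hb]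
    have h := discrT θ n hn hpos h0 b hb
    refine div_le_of_le_mul₀ (Real.sqrt_nonneg _) (by positivity) ?_
    rw [le_inv_mul_iff₀ (by positivity)]
    refine Real.le_sqrt_of_sq_le ?_
    rw [mul_pow, Real.sq_sqrt (Finset.sum_nonneg fun j _ => sq_nonneg _)]
    nlinarith [sq_nonneg (c + b 0)]
end
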